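/- Let n ≥ 2, let g be an inner product on ℝⁿ and let g* be the dual inner product on the dual space (ℝⁿ)*, characterized by g*(β,β) = sup_{w ≠ 0} β(w)²/g(w,w). Let F : ℝⁿ → [0,∞) be continuous with F(w) > 0 for w ≠ 0 and F(cw) = cF(w) for all c ≥ 0, and let F*(β) := sup{β(w) : F(w) ≤ 1} be its dual. Then sup_{w ≠ 0} g(w,w)/F(w)² = sup_{β ≠ 0} F*(β)²/g*(β,β). -/

import Mathlib

/-- Cauchy–Schwarz for a positive definite symmetric bilinear form. -/
lemma sq_le_mul_of_posDef {V : Type*} [AddCommGroup V] [Module ℝ V]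
    (g : V →ₗ[ℝ] V →ₗ[ℝ] ℝ) (hgsymm : ∀ x y, g x y = g y x)
    (hgpos : ∀ x, x ≠ 0 → 0 < g x x) (u w : V) :
    g u w ^ 2 ≤ g u u * g w w := by
  rcases eq_or_ne w 0 with rfl | hw
  · simp
  have hpos := hgpos w hw
  have hnonneg : 0 ≤ g (g w w • u - g u w • w) (g w w • u - g u w • w) := by
    rcases eq_or_ne (g w w • u - g u w • w) 0 with h | h
    · simp [h]
    · exact (hgpos _ h).le
  have hexpand : g (g w w • u - g u w • w) (g w w • u - g u w • w) =
      g w w * (g u u * g w w - g u w ^ 2) := by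
    simp only [map_sub, map_smul, LinearMap.sub_apply, LinearMap.smul_apply, smul_eq_mul,
      hgsymm w u]
    ring
  rw [hexpand] at hnonneg
  linarith [nonneg_of_mul_nonneg_right hnonneg hpos]

/-- Every linear functional is represented by a vector. -/
lemma exists_representing_vector {n : ℕ} (g : (Fin n → ℝ) →ₗ[ℝ] (Fin n → ℝ) →ₗ[ℝ] ℝ)
    (hgpos : ∀ x, x ≠ 0 → 0 < g x x) (β : (Fin n → ℝ) →L[ℝ] ℝ) :
    ∃ u, ∀ w, β w = g u w := by
  have hinj : Function.Injective g := by
    refine (injective_iff_map_eq_zero g).2 fun u hu => ?_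
    by_contra h
    simpa [hu] using hgpos u h
  have hsurj := (LinearMap.injective_iff_surjective_of_finrank_eq_finrank
    (Subspace.dual_finrank_eq (K := ℝ) (V := Fin n → ℝ)).symm).1 hinj
  obtain ⟨u, hu⟩ := hsurj β.toLinearMap
  exact ⟨u, fun w => by simp [hu]⟩

lemma sSup_sq_div_eq {V : Type*} [AddCommGroup V] [Module ℝ V]
    (g : V →ₗ[ℝ] V →ₗ[ℝ] ℝ) (hgsymm : ∀ x y, g x y = g y x)
    (hgpos : ∀ x, x ≠ 0 → 0 < g x x) {u : V} (hu : u ≠ 0) :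
    sSup {r : ℝ | ∃ w, w ≠ 0 ∧ r = g u w ^ 2 / g w w} = g u u := by
  refine IsGreatest.csSup_eq ⟨⟨u, hu, ?_⟩, ?_⟩
  · field_simp [(hgpos u hu).ne']
  · rintro r ⟨w, hw, rfl⟩
    exact (div_le_iff₀ (hgpos w hw)).2 (sq_le_mul_of_posDef g hgsymm hgpos u w)

/-- The ratio `g w w / F w ^ 2` is bounded above, by compactness of the unit sphere. -/
lemma bddAbove_div_sq {n : ℕ} (g : (Fin n → ℝ) →ₗ[ℝ] (Fin n → ℝ) →ₗ[ℝ] ℝ)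
    (F : (Fin n → ℝ) → ℝ) (hFcont : Continuous F) (hFpos : ∀ w, w ≠ 0 → 0 < F w)
    (hFhomog : ∀ c : ℝ, 0 ≤ c → ∀ w, F (c • w) = c * F w) :
    BddAbove {r : ℝ | ∃ w, w ≠ 0 ∧ r = g w w / F w ^ 2} := by
  have hgcont : Continuous fun w => g w w := by
    have h : Continuous fun w => LinearMap.toContinuousLinearMap (g w) :=
      ((LinearMap.toContinuousLinearMap :
        ((Fin n → ℝ) →ₗ[ℝ] ℝ) ≃ₗ[ℝ] _).toLinearMap ∘ₗ g).continuous_of_finiteDimensional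
    exact h.clm_apply continuous_id
  have hcont : ContinuousOn (fun w => g w w / F w ^ 2) (Metric.sphere 0 1) :=
    hgcont.continuousOn.div (hFcont.pow 2).continuousOn fun w hw =>
      (pow_pos (hFpos w (ne_zero_of_mem_unit_sphere ⟨w, hw⟩)) 2).ne'
  obtain ⟨M, hM⟩ := (isCompact_sphere (0 : Fin n → ℝ) 1).bddAbove_image hcont
  refine ⟨M, ?_⟩
  rintro r ⟨w, hw, rfl⟩
  have hnorm : 0 < ‖w‖ := norm_pos_iff.2 hw
  have hmem : ‖w‖⁻¹ • w ∈ Metric.sphere (0 : Fin n → ℝ) 1 := by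
    simp [norm_smul, hnorm.ne']
  have hle := hM ⟨_, hmem, rfl⟩
  have hF := (hFpos w hw).ne'
  have heq : g (‖w‖⁻¹ • w) (‖w‖⁻¹ • w) / F (‖w‖⁻¹ • w) ^ 2 = g w w / F w ^ 2 := by
    rw [hFhomog _ (inv_nonneg.2 hnorm.le)]
    simp only [map_smul, LinearMap.smul_apply, smul_eq_mul]
    field_simp
  rwa [← heq]


/-- The dual (co-)norm of a linear functional `β`:
`F*(β) := sup { β w | F w ≤ 1 }`. -/
noncomputable def dualNorm {n : ℕ} (F : (Fin n → ℝ) → ℝ)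
    (β : (Fin n → ℝ) →L[ℝ] ℝ) : ℝ :=
  sSup {s : ℝ | ∃ w : Fin n → ℝ, F w ≤ 1 ∧ s = β w}

/-- **Duality of the uniform smoothness constant.**
For an inner product `g` on `ℝⁿ` with dual inner product `g*` (characterized by
`g*(β,β) = sup_{w≠0} β(w)²/g(w,w)`) and a continuous positively `1`-homogeneous
`F : ℝⁿ → [0,∞)` positive away from `0`, one has
`sup_{w≠0} g(w,w)/F(w)² = sup_{β≠0} F*(β)²/g*(β,β)`. -/
theorem uniformSmoothness_duality {n : ℕ} (hn : 2 ≤ n)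
    (g : (Fin n → ℝ) →ₗ[ℝ] (Fin n → ℝ) →ₗ[ℝ] ℝ)
    (hgsymm : ∀ x y : Fin n → ℝ, g x y = g y x)
    (hgpos : ∀ x : Fin n → ℝ, x ≠ 0 → 0 < g x x)
    (gstar : ((Fin n → ℝ) →L[ℝ] ℝ) → ℝ)
    (hgstar : ∀ β : (Fin n → ℝ) →L[ℝ] ℝ,
      gstar β = sSup {r : ℝ | ∃ w : Fin n → ℝ, w ≠ 0 ∧ r = (β w) ^ 2 / g w w})
    (F : (Fin n → ℝ) → ℝ) (hFcont : Continuous F) (hFnonneg : ∀ w, 0 ≤ F w)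
    (hFpos : ∀ w : Fin n → ℝ, w ≠ 0 → 0 < F w)
    (hFhomog : ∀ c : ℝ, 0 ≤ c → ∀ w : Fin n → ℝ, F (c • w) = c * F w) :
    sSup {r : ℝ | ∃ w : Fin n → ℝ, w ≠ 0 ∧ r = g w w / F w ^ 2} =
      sSup {r : ℝ | ∃ β : (Fin n → ℝ) →L[ℝ] ℝ, β ≠ 0 ∧
        r = (dualNorm F β) ^ 2 / gstar β} := by
  set L := sSup {r : ℝ | ∃ w : Fin n → ℝ, w ≠ 0 ∧ r = g w w / F w ^ 2}
  have hbdd := bddAbove_div_sq g F hFcont hFpos hFhomog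
  have hg_nonneg (w : Fin n → ℝ) : 0 ≤ g w w := by
    rcases eq_or_ne w 0 with rfl | hw
    · simp
    · exact (hgpos w hw).le
  have hL_nonneg : 0 ≤ L := by
    refine Real.sSup_nonneg ?_
    rintro r ⟨w, -, rfl⟩
    exact div_nonneg (hg_nonneg w) (sq_nonneg _)
  have hF_zero : F 0 = 0 := by simpa using hFhomog 0 le_rfl 0
  have hg_le (w : Fin n → ℝ) (hw : F w ≤ 1) : g w w ≤ L := by
    rcases eq_or_ne w 0 with rfl | hw0
    · simpa using hL_nonneg
    have h : g w w / F w ^ 2 ≤ L := le_csSup hbdd ⟨w, hw0, rfl⟩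
    rw [div_le_iff₀ (pow_pos (hFpos w hw0) 2)] at h
    exact h.trans (mul_le_of_le_one_right hL_nonneg (pow_le_one₀ (hFnonneg w) hw))
  have hupper (β : (Fin n → ℝ) →L[ℝ] ℝ) (u : Fin n → ℝ) (hβ : ∀ w, β w = g u w) :
      √(g u u * L) ∈ upperBounds {s : ℝ | ∃ w, F w ≤ 1 ∧ s = β w} := by
    rintro s ⟨w, hw, rfl⟩
    refine Real.le_sqrt_of_sq_le ?_
    rw [hβ]
    exact (sq_le_mul_of_posDef g hgsymm hgpos u w).trans
      (mul_le_mul_of_nonneg_left (hg_le w hw) (hg_nonneg u))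
  have hgstar_eq (β : (Fin n → ℝ) →L[ℝ] ℝ) (u : Fin n → ℝ) (hu : u ≠ 0)
      (hβ : ∀ w, β w = g u w) : gstar β = g u u := by
    simp only [hgstar, hβ]
    exact sSup_sq_div_eq g hgsymm hgpos hu
  have hdual_le : L ∈ upperBounds {r : ℝ | ∃ β : (Fin n → ℝ) →L[ℝ] ℝ, β ≠ 0 ∧
      r = (dualNorm F β) ^ 2 / gstar β} := by
    rintro r ⟨β, hβ0, rfl⟩
    obtain ⟨u, hβ⟩ := exists_representing_vector g hgpos β
    have hu : u ≠ 0 := by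
      rintro rfl
      exact hβ0 (ContinuousLinearMap.ext fun w => by simp [hβ])
    have hmem : (0 : ℝ) ∈ {s : ℝ | ∃ w, F w ≤ 1 ∧ s = β w} := ⟨0, by simp [hF_zero], by simp⟩
    have hnonneg : 0 ≤ dualNorm F β := le_csSup ⟨_, hupper β u hβ⟩ hmem
    have hle : dualNorm F β ≤ √(g u u * L) := csSup_le ⟨0, hmem⟩ (hupper β u hβ)
    rw [hgstar_eq β u hu hβ, div_le_iff₀ (hgpos u hu), mul_comm]
    exact (Real.le_sqrt hnonneg (mul_nonneg (hg_nonneg u) hL_nonneg)).1 hle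
  refine le_antisymm ?_ (Real.sSup_le (fun r hr => hdual_le hr) hL_nonneg)
  refine Real.sSup_le ?_ (Real.sSup_nonneg ?_)
  · rintro r ⟨u, hu, rfl⟩
    set β : (Fin n → ℝ) →L[ℝ] ℝ := LinearMap.toContinuousLinearMap (g u)
    have hβ (w : Fin n → ℝ) : β w = g u w := rfl
    have hFu := hFpos u hu
    have hgu := hgpos u hu
    have hβ0 : β ≠ 0 := fun h => hgu.ne' (by rw [← hβ, h]; rfl)
    have hle : g u u / F u ≤ dualNorm F β := by
      refine le_csSup ⟨_, hupper β u hβ⟩ ⟨(F u)⁻¹ • u, ?_, ?_⟩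
      · rw [hFhomog _ (inv_nonneg.2 hFu.le), inv_mul_cancel₀ hFu.ne']
      · rw [hβ, map_smul, smul_eq_mul, div_eq_inv_mul]
    refine le_trans ?_ (le_csSup ⟨L, hdual_le⟩ ⟨β, hβ0, rfl⟩)
    rw [hgstar_eq β u hu hβ, le_div_iff₀ hgu]
    calc g u u / F u ^ 2 * g u u = (g u u / F u) ^ 2 := by ring
      _ ≤ dualNorm F β ^ 2 := pow_le_pow_left₀ (div_nonneg hgu.le hFu.le) hle 2
  · rintro r ⟨β, -, rfl⟩
    rw [hgstar]
    refine div_nonneg (sq_nonneg _) (Real.sSup_nonneg ?_)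
    rintro s ⟨w, -, rfl⟩
    exact div_nonneg (sq_nonneg _) (hg_nonneg w)
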